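/- At x = y = z = (2n+3)^{−4n/(4n+3)} with s = (xyz)^{−1/(4n)}, the Hessian of the normalized Ricci flow vector field, written in the symmetric form [[a,b,b],[b,a,b],[b,b,a]], has a = −8(2n²+7n+5)(2n+3)^{−(4n+6)/(4n+3)} and b = 16(n+1)(n+2)(2n+3)^{−(4n+6)/(4n+3)}; the eigenvalues a+2b and a−b (the latter with multiplicity 2) satisfy a + 2b > 0 and a − b < 0. Hence Jensen's second Einstein metric is a saddle point of the normalized flow. -/

import Mathlib

noncomputable def rI (n : ℕ) (x y z s : ℝ) : ℝ :=
  2 * ((x^2 - y^2 - z^2) / (x*y*z)) + 4/x + 4*n*x/s^2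

noncomputable def rJ (n : ℕ) (x y z s : ℝ) : ℝ :=
  2 * ((y^2 - x^2 - z^2) / (x*y*z)) + 4/y + 4*n*y/s^2

noncomputable def rK (n : ℕ) (x y z s : ℝ) : ℝ :=
  2 * ((z^2 - x^2 - y^2) / (x*y*z)) + 4/z + 4*n*z/s^2

noncomputable def rH (n : ℕ) (x y z s : ℝ) : ℝ :=
  -2 * ((x + y + z) / s^2) + (4*n + 8)/s

noncomputable def Scal (n : ℕ) (x y z s : ℝ) : ℝ :=
  rI n x y z s + rJ n x y z s + rK n x y z s + 4*n * rH n x y z s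

noncomputable def sVol (n : ℕ) (x y z : ℝ) : ℝ :=
  (x*y*z) ^ (-(1 / (4*(n:ℝ))))

/-- The normalized Ricci flow vector field in the coordinates `(x,y,z)` with
`s = (xyz)^{-1/(4n)}`. -/
noncomputable def flowField (n : ℕ) (p : Fin 3 → ℝ) : Fin 3 → ℝ :=
  let x := p 0; let y := p 1; let z := p 2; let s := sVol n (p 0) (p 1) (p 2)
  ![-2 * x * (rI n x y z s - Scal n x y z s / (4*n + 3)),
    -2 * y * (rJ n x y z s - Scal n x y z s / (4*n + 3)),
    -2 * z * (rK n x y z s - Scal n x y z s / (4*n + 3))]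

lemma rI_deriv (n : ℕ) {x y z s : ℝ → ℝ} {c s0 x' y' z' s' : ℝ} (hc : 0 < c) (hs0 : 0 < s0)
    (hx : HasDerivAt x x' 0) (hy : HasDerivAt y y' 0) (hz : HasDerivAt z z' 0)
    (hs : HasDerivAt s s' 0) (x0 : x 0 = c) (y0 : y 0 = c) (z0 : z 0 = c) (s00 : s 0 = s0) :
    HasDerivAt (fun t => rI n (x t) (y t) (z t) (s t))
      (2*(2*(x'-y'-z') + (x'+y'+z'))/c^2 - 4*x'/c^2 + 4*n*x'/s0^2 - 8*n*c*s'/s0^3) 0 := by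
  unfold rI
  have hN := ((hx.fun_pow 2).fun_sub (hy.fun_pow 2)).fun_sub (hz.fun_pow 2)
  have hD := (hx.fun_mul hy).fun_mul hz
  have h1 := (hN.fun_div hD (by simp only [x0, y0, z0]; positivity)).const_mul 2
  have h2 := (hasDerivAt_const (0:ℝ) (4:ℝ)).fun_div hx (by rw [x0]; positivity)
  have h3 := (hx.const_mul (4*(n:ℝ))).fun_div (hs.fun_pow 2) (by rw [s00]; positivity)
  refine HasDerivAt.congr_deriv ((h1.fun_add h2).fun_add h3) ?_
  simp only [x0, y0, z0, s00]
  field_simp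
  push_cast
  ring

lemma rH_deriv (n : ℕ) {x y z s : ℝ → ℝ} {c s0 x' y' z' s' : ℝ} (hc : 0 < c) (hs0 : 0 < s0)
    (hx : HasDerivAt x x' 0) (hy : HasDerivAt y y' 0) (hz : HasDerivAt z z' 0)
    (hs : HasDerivAt s s' 0) (x0 : x 0 = c) (y0 : y 0 = c) (z0 : z 0 = c) (s00 : s 0 = s0) :
    HasDerivAt (fun t => rH n (x t) (y t) (z t) (s t))
      (-2*(x'+y'+z')/s0^2 + 12*c*s'/s0^3 - (4*n+8)*s'/s0^2) 0 := by
  unfold rH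
  have h1 := (((hx.fun_add hy).fun_add hz).fun_div (hs.fun_pow 2)
    (by rw [s00]; positivity)).const_mul (-2)
  have h2 := (hasDerivAt_const (0:ℝ) (4*(n:ℝ)+8)).fun_div hs (by rw [s00]; positivity)
  refine HasDerivAt.congr_deriv (h1.fun_add h2) ?_
  simp only [x0, y0, z0, s00]
  field_simp
  push_cast
  ring

lemma rJ_eq (n : ℕ) (x y z s : ℝ) : rJ n x y z s = rI n y x z s := by
  unfold rI rJ
  rw [mul_comm x y]

lemma rK_eq (n : ℕ) (x y z s : ℝ) : rK n x y z s = rI n z x y s := by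
  unfold rI rK
  rw [show x * y * z = z * x * y by ring]

/-- The value of the derivative of one component. -/
lemma comp_deriv (n : ℕ) (hn : 1 ≤ n) {x y z s : ℝ → ℝ} {c x' y' z' : ℝ} (hc : 0 < c)
    (hx : HasDerivAt x x' 0) (hy : HasDerivAt y y' 0) (hz : HasDerivAt z z' 0)
    (hs : HasDerivAt s (-(2*n+3)/(4*n)*(x'+y'+z')) 0)
    (x0 : x 0 = c) (y0 : y 0 = c) (z0 : z 0 = c) (s00 : s 0 = (2*n+3)*c) :
    HasDerivAt (fun t => -2 * x t * (rI n (x t) (y t) (z t) (s t) -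
        Scal n (x t) (y t) (z t) (s t) / (4*n + 3)))
      ((-8 * (2*(n:ℝ)^2 + 7*n + 5) * x' + 16 * ((n:ℝ)+1) * ((n:ℝ)+2) * (y' + z'))
        / ((2*n+3)^2 * c)) 0 := by
  have hn' : (0:ℝ) < n := by exact_mod_cast hn
  have hs0 : (0:ℝ) < (2*n+3)*c := by positivity
  have hI := rI_deriv n hc hs0 hx hy hz hs x0 y0 z0 s00
  have hJ := rI_deriv n hc hs0 hy hx hz hs y0 x0 z0 s00
  have hK := rI_deriv n hc hs0 hz hx hy hs z0 x0 y0 s00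
  have hH := rH_deriv n hc hs0 hx hy hz hs x0 y0 z0 s00
  have hS := ((hI.fun_add hJ).fun_add hK).fun_add (hH.const_mul (4*(n:ℝ)))
  have hT := (hx.const_mul (-2)).fun_mul (hI.fun_sub (hS.div_const (4*(n:ℝ)+3)))
  unfold Scal
  simp only [rJ_eq, rK_eq]
  refine HasDerivAt.congr_deriv (hT) ?_
  simp only [x0, y0, z0, s00, rI, rH]
  field_simp
  ring

lemma sVol_deriv (n : ℕ) {x y z : ℝ → ℝ} {c s0 x' y' z' : ℝ} (hc : 0 < c)
    (hx : HasDerivAt x x' 0) (hy : HasDerivAt y y' 0) (hz : HasDerivAt z z' 0)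
    (x0 : x 0 = c) (y0 : y 0 = c) (z0 : z 0 = c) (h0 : sVol n c c c = s0) :
    HasDerivAt (fun t => sVol n (x t) (y t) (z t)) (-(1/(4*(n:ℝ)))*(s0/c)*(x'+y'+z')) 0 := by
  have hD := (hx.fun_mul hy).fun_mul hz
  have hne : x 0 * y 0 * z 0 ≠ 0 := by simp only [x0, y0, z0]; positivity
  have h := hD.rpow_const (p := -(1/(4*(n:ℝ)))) (Or.inl hne)
  unfold sVol at *
  convert h using 1
  simp only [x0, y0, z0]
  rw [Real.rpow_sub_one (by positivity), h0]
  field_simp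

lemma flow_diff (n : ℕ) {c : ℝ} (hc : 0 < c) :
    DifferentiableAt ℝ (flowField n) (fun _ => c) := by
  rw [differentiableAt_pi]
  have hs : DifferentiableAt ℝ (fun p : Fin 3 → ℝ => sVol n (p 0) (p 1) (p 2)) (fun _ => c) := by
    unfold sVol
    refine DifferentiableAt.rpow_const (by fun_prop) (Or.inl ?_)
    positivity
  have hs0 : sVol n c c c ≠ 0 := by unfold sVol; positivity
  have hP : ∀ f g : (Fin 3 → ℝ) → ℝ, DifferentiableAt ℝ f (fun _ => c) →
      DifferentiableAt ℝ g (fun _ => c) → g (fun _ => c) ≠ 0 →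
      DifferentiableAt ℝ (fun p => f p / g p) (fun _ => c) := by
    intro f g hf hg h
    simp only [div_eq_mul_inv]
    exact hf.fun_mul (hg.fun_inv h)
  have hc0 : c ≠ 0 := hc.ne'
  have hI : ∀ i j k : Fin 3, DifferentiableAt ℝ
      (fun p : Fin 3 → ℝ => rI n (p i) (p j) (p k) (sVol n (p 0) (p 1) (p 2))) (fun _ => c) := by
    intro i j k
    unfold rI
    refine ((DifferentiableAt.const_mul (hP _ _ (by fun_prop) (by fun_prop) ?_) _).fun_add
      (hP _ _ (by fun_prop) (by fun_prop) ?_)).fun_add (hP _ _ (by fun_prop) (by fun_prop) ?_) <;>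
    positivity
  have hH : DifferentiableAt ℝ
      (fun p : Fin 3 → ℝ => rH n (p 0) (p 1) (p 2) (sVol n (p 0) (p 1) (p 2))) (fun _ => c) := by
    unfold rH
    refine (DifferentiableAt.const_mul (hP _ _ (by fun_prop) (by fun_prop) ?_) _).fun_add
      (hP _ _ (by fun_prop) (by fun_prop) ?_) <;>
    positivity
  have h1 := hI 0 1 2
  have h2 := hI 1 0 2
  have h3 := hI 2 0 1
  intro i
  fin_cases i <;> simp [flowField, Scal, rJ_eq, rK_eq] <;> fun_prop

lemma Scal_swap (n : ℕ) (x y z s : ℝ) : Scal n x y z s = Scal n y x z s := by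
  unfold Scal rI rJ rK rH
  rw [mul_comm x y]; ring

lemma Scal_rot (n : ℕ) (x y z s : ℝ) : Scal n x y z s = Scal n z x y s := by
  unfold Scal rI rJ rK rH
  rw [show x * y * z = z * x * y by ring]; ring

lemma flow_fderiv (n : ℕ) (hn : 1 ≤ n) {c : ℝ} (hc : 0 < c)
    (h0 : sVol n c c c = (2*n+3)*c) (i j : Fin 3) :
    (fderiv ℝ (flowField n) (fun _ => c)) (Pi.single j 1) i
      = if i = j then -8 * (2*(n:ℝ)^2 + 7*n + 5) / ((2*n+3)^2 * c)
        else 16 * ((n:ℝ)+1) * ((n:ℝ)+2) / ((2*n+3)^2 * c) := by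
  have hn' : (0:ℝ) < n := by exact_mod_cast hn
  set e : Fin 3 → ℝ := Pi.single j 1 with he
  have hl : ∀ k : Fin 3, HasDerivAt (fun t : ℝ => c + t * e k) (e k) 0 := by
    intro k
    simpa using ((hasDerivAt_id (0:ℝ)).mul_const (e k)).const_add c
  have hline : HasDerivAt (fun t : ℝ => (fun k => c + t * e k : Fin 3 → ℝ)) e 0 :=
    hasDerivAt_pi.2 hl
  have hd : HasFDerivAt (flowField n) (fderiv ℝ (flowField n) (fun _ => c))
      ((fun t : ℝ => (fun k => c + t * e k : Fin 3 → ℝ)) 0) := by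
    simpa using (flow_diff n hc).hasFDerivAt
  have hcomp := hasDerivAt_pi.1 (hd.comp_hasDerivAt (0:ℝ) hline) i
  have hz : ∀ k : Fin 3, (fun t : ℝ => c + t * e k) 0 = c := by intro k; simp
  have hs := sVol_deriv n hc (hl 0) (hl 1) (hl 2) (hz 0) (hz 1) (hz 2) h0
  have hs' : HasDerivAt (fun t : ℝ => sVol n (c + t * e 0) (c + t * e 1) (c + t * e 2))
      (-(2*n+3)/(4*n)*(e 0+e 1+e 2)) 0 := by
    convert hs using 1
    field_simp
  have hs0 : (fun t : ℝ => sVol n (c + t * e 0) (c + t * e 1) (c + t * e 2)) 0 = (2*n+3)*c := by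
    simpa using h0
  have k0 := comp_deriv n hn hc (hl 0) (hl 1) (hl 2) hs' (hz 0) (hz 1) (hz 2) hs0
  have k1 := comp_deriv n hn hc (hl 1) (hl 0) (hl 2) (by convert hs' using 1; ring)
    (hz 1) (hz 0) (hz 2) hs0
  have k2 := comp_deriv n hn hc (hl 2) (hl 0) (hl 1) (by convert hs' using 1; ring)
    (hz 2) (hz 0) (hz 1) hs0
  simp only [← rJ_eq, ← Scal_swap] at k1
  simp only [← rK_eq, ← Scal_rot] at k2
  fin_cases i
  · rw [HasDerivAt.unique hcomp k0]
    fin_cases j <;> simp [he]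
  · rw [HasDerivAt.unique hcomp k1]
    fin_cases j <;> simp [he]
  · rw [HasDerivAt.unique hcomp k2]
    fin_cases j <;> simp [he]

/-- At Jensen's second Einstein metric `x = y = z = (2n+3)^{-4n/(4n+3)}`, the
linearization of the normalized Ricci flow has the circulant form
`[[a,b,b],[b,a,b],[b,b,a]]` with the stated values of `a` and `b`, and its
eigenvalues satisfy `a + 2b > 0` and `a − b < 0`: a saddle point. -/
theorem jensen_saddle (n : ℕ) (hn : 1 ≤ n) :
    let c : ℝ := (2*(n:ℝ)+3) ^ (-(4*(n:ℝ)) / (4*(n:ℝ)+3))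
    let a : ℝ := -8 * (2*(n:ℝ)^2 + 7*n + 5)
        * (2*(n:ℝ)+3) ^ (-((4*(n:ℝ)+6) / (4*(n:ℝ)+3)))
    let b : ℝ := 16 * ((n:ℝ)+1) * ((n:ℝ)+2)
        * (2*(n:ℝ)+3) ^ (-((4*(n:ℝ)+6) / (4*(n:ℝ)+3)))
    (∀ i j : Fin 3,
      (fderiv ℝ (flowField n) (fun _ => c)) (Pi.single j 1) i
        = if i = j then a else b)
    ∧ 0 < a + 2*b ∧ a - b < 0 := by
  intro c a b
  have hn' : (0:ℝ) < n := by exact_mod_cast hn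
  have hm : (0:ℝ) < 2*(n:ℝ)+3 := by positivity
  have hc : 0 < c := Real.rpow_pos_of_pos hm _
  have hk : (0:ℝ) < (2*(n:ℝ)+3) ^ (-((4*(n:ℝ)+6) / (4*(n:ℝ)+3))) := Real.rpow_pos_of_pos hm _
  have h0 : sVol n c c c = (2*n+3)*c := by
    have h3 : c * c * c = (2*(n:ℝ)+3) ^ (3 * (-(4*(n:ℝ)) / (4*(n:ℝ)+3))) := by
      simp only [c]
      rw [← Real.rpow_add hm, ← Real.rpow_add hm]
      congr 1; ring
    unfold sVol
    rw [h3, ← Real.rpow_mul hm.le]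
    simp only [c]
    nth_rewrite 2 [← Real.rpow_one (2*(n:ℝ)+3)]
    rw [← Real.rpow_add hm]
    congr 1
    field_simp
    ring
  have hkc : (2*(n:ℝ)+3) ^ (-((4*(n:ℝ)+6) / (4*(n:ℝ)+3))) = 1 / ((2*n+3)^2 * c) := by
    rw [eq_div_iff (by positivity)]
    simp only [c]
    rw [← Real.rpow_natCast, ← Real.rpow_add hm, ← Real.rpow_add hm,
      ← Real.rpow_zero (2*(n:ℝ)+3)]
    congr 1
    push_cast
    field_simp
    ring
  refine ⟨?_, ?_, ?_⟩
  · intro i j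
    rw [flow_fderiv n hn hc h0]
    simp only [a, b, hkc]
    split_ifs <;> ring
  · have : a + 2*b = (16*(n:ℝ)^2 + 40*n + 24) *
        (2*(n:ℝ)+3) ^ (-((4*(n:ℝ)+6) / (4*(n:ℝ)+3))) := by simp only [a, b]; ring
    rw [this]; positivity
  · have : a - b = -((32*(n:ℝ)^2 + 104*n + 72) *
        (2*(n:ℝ)+3) ^ (-((4*(n:ℝ)+6) / (4*(n:ℝ)+3)))) := by simp only [a, b]; ring
    rw [this, neg_lt_zero]; positivity
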